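/- Let (E, μ) be a σ-finite measure space, θ ∈ L¹(μ), and (θ_n) a sequence in L¹(μ) such that r_n·‖θ_n − θ‖_{L¹} is bounded for some sequence r_n ↑ ∞. Let (a_n) be positive reals with a_n ↓ 0 and a_n·r_n ↑ ∞, and let (h_n) be a sequence in L¹(μ) with ‖h_n − h‖_{L¹} → 0 for some h ∈ L¹(μ). Then the estimated derivative δ̂'_n(h_n) = ∫_{{|θ_n| ≤ a_n}} |h_n| dμ + ∫_{{|θ_n| > a_n}} h_n·sgn(θ_n) dμ converges to the Hadamard directional derivative δ'_θ(h) = ∫_{{θ=0}} |h| dμ + ∫_{{θ≠0}} h·sgn(θ) dμ. -/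

import Mathlib

open MeasureTheory Filter Topology

/-- The integrand of the estimated derivative of the `L¹`-norm: `|y|` where the estimator value `t`
is at most the threshold `a` in modulus, and `y * sgn t` elsewhere. -/
noncomputable def thresholdIntegrand (a t y : ℝ) : ℝ :=
  if |t| ≤ a then |y| else y * Real.sign t

lemma abs_real_sign_le_one (t : ℝ) : |Real.sign t| ≤ 1 := by
  rcases Real.sign_apply_eq t with h | h | h <;> simp [h]

lemma abs_thresholdIntegrand_sub_le (a t y z : ℝ) :
    |thresholdIntegrand a t y - thresholdIntegrand a t z| ≤ |y - z| := by
  unfold thresholdIntegrand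
  split_ifs
  · exact abs_abs_sub_abs_le_abs_sub y z
  · rw [← sub_mul, abs_mul]
    exact mul_le_of_le_one_right (abs_nonneg _) (abs_real_sign_le_one t)

lemma abs_thresholdIntegrand_le (a t y : ℝ) : |thresholdIntegrand a t y| ≤ |y| := by
  simpa [thresholdIntegrand] using abs_thresholdIntegrand_sub_le a t y 0

lemma measurable_real_sign : Measurable Real.sign := by
  unfold Real.sign
  exact Measurable.ite measurableSet_Iio measurable_const
    (Measurable.ite measurableSet_Ioi measurable_const measurable_const)

section

variable {E : Type*} [MeasurableSpace E] {μ : Measure E}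

lemma measurable_thresholdIntegrand {a : ℝ} {f g : E → ℝ} (hf : Measurable f)
    (hg : Measurable g) : Measurable fun x => thresholdIntegrand a (f x) (g x) := by
  unfold thresholdIntegrand
  exact Measurable.ite (measurableSet_le hf.abs measurable_const) hg.abs
    (hg.mul (measurable_real_sign.comp hf))

lemma integrable_thresholdIntegrand {a : ℝ} {f g : E → ℝ} (hf : Measurable f)
    (hg : Measurable g) (hgi : Integrable g μ) :
    Integrable (fun x => thresholdIntegrand a (f x) (g x)) μ :=
  hgi.mono (measurable_thresholdIntegrand hf hg).aestronglyMeasurable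
    (ae_of_all _ fun _ => abs_thresholdIntegrand_le _ _ _)

lemma integral_thresholdIntegrand {a : ℝ} {f g : E → ℝ} (hf : Measurable f)
    (hg : Measurable g) (hgi : Integrable g μ) :
    ∫ x, thresholdIntegrand a (f x) (g x) ∂μ =
      (∫ x in {x | |f x| ≤ a}, |g x| ∂μ) +
        ∫ x in {x | a < |f x|}, g x * Real.sign (f x) ∂μ := by
  have hs : MeasurableSet {x | |f x| ≤ a} := measurableSet_le hf.abs measurable_const
  have hc : {x | a < |f x|} = {x | |f x| ≤ a}ᶜ := by ext; simp
  rw [← integral_add_compl hs (integrable_thresholdIntegrand hf hg hgi), hc]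
  congr 1
  · exact setIntegral_congr_fun hs fun x hx => if_pos hx
  · exact setIntegral_congr_fun hs.compl fun x hx => if_neg hx

/-- `L¹` convergence to zero implies almost everywhere convergence along a subsequence. -/
lemma exists_seq_tendsto_ae_zero_of_tendsto_integral_abs {u : ℕ → E → ℝ}
    (hu : ∀ n, Integrable (u n) μ)
    (hlim : Tendsto (fun n => ∫ x, |u n x| ∂μ) atTop (𝓝 0)) :
    ∃ ms : ℕ → ℕ, StrictMono ms ∧
      ∀ᵐ x ∂μ, Tendsto (fun n => u (ms n) x) atTop (𝓝 0) := by
  have hm : TendstoInMeasure μ u atTop (fun _ => (0 : ℝ)) := by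
    refine tendstoInMeasure_of_tendsto_eLpNorm one_ne_zero
      (fun n => (hu n).aestronglyMeasurable) aestronglyMeasurable_const ?_
    have heq : ∀ n, eLpNorm (u n - fun _ => (0 : ℝ)) 1 μ =
        ENNReal.ofReal (∫ x, |u n x| ∂μ) := by
      intro n
      have h0 : (u n - fun _ => (0 : ℝ)) = u n := by ext; simp
      rw [h0, eLpNorm_one_eq_lintegral_enorm, ← ofReal_integral_norm_eq_lintegral_enorm (hu n)]
      rfl
    simp_rw [heq]
    simpa using ENNReal.tendsto_ofReal hlim
  exact hm.exists_seq_tendsto_ae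

end

/-- If `t n` approximates `s` with an error of smaller order than the threshold `a n → 0`, then the
thresholded integrand is eventually equal to the exact one. -/
lemma eventually_thresholdIntegrand_eq {a t : ℕ → ℝ} {s : ℝ} (y : ℝ) (hapos : ∀ n, 0 < a n)
    (ha0 : Tendsto a atTop (𝓝 0))
    (hts : Tendsto (fun n => (t n - s) / a n) atTop (𝓝 0)) :
    ∀ᶠ n in atTop, thresholdIntegrand (a n) (t n) y = thresholdIntegrand 0 s y := by
  have hsmall : ∀ᶠ n in atTop, |t n - s| < a n := by
    have h1 := hts.abs
    rw [abs_zero] at h1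
    filter_upwards [h1.eventually_lt_const one_pos] with n hn
    rwa [abs_div, abs_of_pos (hapos n), div_lt_one (hapos n)] at hn
  by_cases hs : s = 0
  · filter_upwards [hsmall] with n hn
    rw [hs, sub_zero] at hn
    simp [thresholdIntegrand, hs, hn.le]
  · have hspos : 0 < |s| / 2 := by positivity
    filter_upwards [hsmall, ha0.eventually_lt_const hspos] with n hn han
    have hlarge : ¬ |t n| ≤ a n := by
      have := abs_sub_abs_le_abs_sub s (t n)
      rw [abs_sub_comm] at this
      linarith
    have hs0 : ¬ |s| ≤ 0 := by simpa using hs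
    have hsign : Real.sign (t n) = Real.sign s := by
      rw [abs_lt] at hn
      rcases lt_or_gt_of_ne hs with hneg | hpos
      · rw [abs_of_neg hneg] at han
        rw [Real.sign_of_neg hneg, Real.sign_of_neg (by linarith)]
      · rw [abs_of_pos hpos] at han
        rw [Real.sign_of_pos hpos, Real.sign_of_pos (by linarith)]
    simp only [thresholdIntegrand, if_neg hlarge, if_neg hs0, hsign]

/-- **Consistency of the estimated derivative of the L¹-norm.**
If `r_n ‖θ_n - θ‖₁` is bounded with `r_n ↑ ∞`, `a_n ↓ 0` with `a_n r_n ↑ ∞`, and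
`h_n → h` in `L¹(μ)`, then the estimated derivative
`δ̂'_n(h_n) = ∫_{|θ_n| ≤ a_n} |h_n| + ∫_{|θ_n| > a_n} h_n·sgn(θ_n)` converges to the Hadamard
directional derivative `δ'_θ(h) = ∫_{θ=0} |h| + ∫_{θ≠0} h·sgn(θ)`. -/
theorem estimated_L1_derivative_consistency
    {E : Type*} [MeasurableSpace E] (μ : Measure E) [SigmaFinite μ]
    (θ : E → ℝ) (hmθ : Measurable θ) (hθ : Integrable θ μ)
    (θn : ℕ → E → ℝ) (hmθn : ∀ n, Measurable (θn n)) (hθn : ∀ n, Integrable (θn n) μ)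
    (r : ℕ → ℝ) (hrpos : ∀ n, 0 < r n) (hrmono : Monotone r)
    (hrtop : Tendsto r atTop atTop)
    (hbound : ∃ C : ℝ, ∀ n, r n * ∫ x, |θn n x - θ x| ∂μ ≤ C)
    (a : ℕ → ℝ) (hapos : ∀ n, 0 < a n) (haanti : Antitone a)
    (ha0 : Tendsto a atTop (𝓝 0))
    (harmono : Monotone (fun n => a n * r n))
    (hartop : Tendsto (fun n => a n * r n) atTop atTop)
    (h : E → ℝ) (hmh : Measurable h) (hh : Integrable h μ)
    (hn : ℕ → E → ℝ) (hmhn : ∀ n, Measurable (hn n)) (hhn : ∀ n, Integrable (hn n) μ)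
    (hconv : Tendsto (fun n => ∫ x, |hn n x - h x| ∂μ) atTop (𝓝 0)) :
    Tendsto (fun n =>
        (∫ x in {x | |θn n x| ≤ a n}, |hn n x| ∂μ) +
          ∫ x in {x | a n < |θn n x|}, hn n x * Real.sign (θn n x) ∂μ) atTop
      (𝓝 ((∫ x in {x | θ x = 0}, |h x| ∂μ) +
        ∫ x in {x | θ x ≠ 0}, h x * Real.sign (θ x) ∂μ)) := by
  obtain ⟨C, hC⟩ := hbound
  have hlim : (∫ x in {x | θ x = 0}, |h x| ∂μ) + ∫ x in {x | θ x ≠ 0}, h x * Real.sign (θ x) ∂μ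
      = ∫ x, thresholdIntegrand 0 (θ x) (h x) ∂μ := by
    simp [integral_thresholdIntegrand hmθ hmh hh]
  rw [hlim]
  simp_rw [← integral_thresholdIntegrand (hmθn _) (hmhn _) (hhn _)]
  have hui : ∀ n, Integrable (fun x => (θn n x - θ x) / a n) μ := fun n =>
    ((hθn n).sub hθ).div_const _
  have hu : Tendsto (fun n => ∫ x, |(θn n x - θ x) / a n| ∂μ) atTop (𝓝 0) := by
    refine squeeze_zero (fun n => integral_nonneg fun x => abs_nonneg _) (fun n => ?_)
      (hartop.const_div_atTop C)
    simp_rw [abs_div, abs_of_pos (hapos n)]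
    rw [integral_div, div_le_div_iff₀ (hapos n) (mul_pos (hapos n) (hrpos n))]
    nlinarith [mul_le_mul_of_nonneg_left (hC n) (hapos n).le]
  have hfix : Tendsto (fun n => ∫ x, thresholdIntegrand (a n) (θn n x) (h x) ∂μ) atTop
      (𝓝 (∫ x, thresholdIntegrand 0 (θ x) (h x) ∂μ)) := by
    refine tendsto_of_subseq_tendsto fun ns hns => ?_
    obtain ⟨ms, hms, hae⟩ := exists_seq_tendsto_ae_zero_of_tendsto_integral_abs
      (fun n => hui (ns n)) (hu.comp hns)
    refine ⟨ms, tendsto_integral_of_dominated_convergence (fun x => |h x|)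
      (fun n => (measurable_thresholdIntegrand (hmθn _) hmh).aestronglyMeasurable) hh.abs
      (fun n => ae_of_all _ fun x => abs_thresholdIntegrand_le _ _ _) ?_⟩
    filter_upwards [hae] with x hx
    exact tendsto_nhds_of_eventually_eq (eventually_thresholdIntegrand_eq (h x)
      (fun n => hapos (ns (ms n))) (ha0.comp (hns.comp hms.tendsto_atTop)) hx)
  have hdiff : Tendsto (fun n => (∫ x, thresholdIntegrand (a n) (θn n x) (hn n x) ∂μ) -
      ∫ x, thresholdIntegrand (a n) (θn n x) (h x) ∂μ) atTop (𝓝 0) := by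
    refine squeeze_zero_norm (fun n => ?_) hconv
    rw [← integral_sub (integrable_thresholdIntegrand (hmθn n) (hmhn n) (hhn n))
      (integrable_thresholdIntegrand (hmθn n) hmh hh)]
    exact norm_integral_le_of_norm_le ((hhn n).sub hh).abs
      (ae_of_all _ fun x => abs_thresholdIntegrand_sub_le _ _ _ _)
  simpa using hdiff.add hfix
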